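/- Let H be a connected graded commutative Hopf algebra over ℂ, φ ∈ G_A a local character, f: g_A → g_A an Ad-covariant map, X = f(R̃(φ)), and let exp(−tX) = g_-(t)^{-1}⋆g_+(t) be the Birkhoff factorization. If φ_t ∈ G_A is any character with R̃(φ_t) = Ad(g_+(t))(R̃(φ)), then φ_t is local. (Equivalently: via the bijection R̃: G_A → g_A, the Lax pair flow L(t) = Ad(g_+(t))(R̃(φ)) transfers to a flow φ_t = R̃^{-1}(L(t)) consisting of local characters, so locality of counterterms is preserved by the Lax pair flow.) -/

import Mathlib

open scoped TensorProduct

set_option synthInstance.maxHeartbeats 1000000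
set_option maxHeartbeats 1600000
set_option linter.unnecessarySeqFocus false

noncomputable section

/-- The algebra `A = ℂ((λ))` of formal Laurent series with finite pole part. -/
abbrev LS := LaurentSeries ℂ

/-- `ℂ`-scalars commute with multiplication of Laurent series. -/
instance : SMulCommClass ℂ LS LS := by
  constructor
  intro c a b
  show c • (a * b) = a * (c • b)
  rw [← HahnSeries.single_zero_mul_eq_smul, ← HahnSeries.single_zero_mul_eq_smul]
  ring

/-- Scalar tower for `ℂ`-scalars and Laurent series. -/
instance : IsScalarTower ℂ LS LS := by
  constructor
  intro c a b
  show (c • a) * b = c • (a * b)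
  rw [← HahnSeries.single_zero_mul_eq_smul, ← HahnSeries.single_zero_mul_eq_smul]
  ring

/-- `A₊ = ℂ[[λ]]`: the holomorphic part. -/
def Aplus (f : LS) : Prop := ∀ n : ℤ, n < 0 → f.coeff n = 0

/-- `A₋ = λ⁻¹ℂ[λ⁻¹]`: the polar part. -/
def Aminus (f : LS) : Prop := ∀ n : ℤ, 0 ≤ n → f.coeff n = 0

/-- The formal variable `λ`. -/
def lam : LS := HahnSeries.single (1 : ℤ) (1 : ℂ)

/-- `λ^k` for `k : ℤ`. -/
def lamZ (k : ℤ) : LS := HahnSeries.single k (1 : ℂ)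

/-- `e^{cλ} = Σ_k c^k λ^k / k!` as a Laurent series. -/
def expL (c : ℂ) : LS :=
  HahnSeries.ofPowerSeries ℤ ℂ (PowerSeries.mk fun k => c ^ k / (k.factorial : ℂ))

section Hopf

variable {H : Type} [Ring H] [HopfAlgebra ℂ H]

/-- Convolution product of linear maps from a Hopf algebra to `A`. -/
def conv (f g : H →ₗ[ℂ] LS) : H →ₗ[ℂ] LS :=
  LinearMap.mul' ℂ LS ∘ₗ TensorProduct.map f g ∘ₗ Coalgebra.comul

/-- The unit `ε` of the convolution algebra. -/
def epsA : H →ₗ[ℂ] LS := LinearMap.toSpanSingleton ℂ LS 1 ∘ₗ Coalgebra.counit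

/-- Characters: algebra morphisms `H → A` sending `1` to `1`. -/
def IsCharacter (φ : H →ₗ[ℂ] LS) : Prop :=
  φ 1 = 1 ∧ ∀ x y : H, φ (x * y) = φ x * φ y

/-- The group inverse of a character: `φ⁻¹ = φ ∘ S`. -/
def charInv (φ : H →ₗ[ℂ] LS) : H →ₗ[ℂ] LS := φ ∘ₗ HopfAlgebra.antipode (R := ℂ)

/-- Infinitesimal characters: `Z(xy) = Z(x)ε(y) + ε(x)Z(y)`. -/
def IsInfChar (Z : H →ₗ[ℂ] LS) : Prop :=
  ∀ x y : H, Z (x * y) = Z x * epsA y + epsA x * Z y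

/-- The Lie bracket `[Z,Z'] = Z⋆Z' − Z'⋆Z` on infinitesimal characters. -/
def lieBr (Z W : H →ₗ[ℂ] LS) : H →ₗ[ℂ] LS := conv Z W - conv W Z

/-- The adjoint action `Ad(g)L = g⋆L⋆g⁻¹`. -/
def Adc (g L : H →ₗ[ℂ] LS) : H →ₗ[ℂ] LS := conv g (conv L (charInv g))

/-- Convolution powers `Z^{⋆k}`. -/
def convPow (Z : H →ₗ[ℂ] LS) : ℕ → (H →ₗ[ℂ] LS)
  | 0 => epsA
  | k + 1 => conv Z (convPow Z k)

/-- `E = exp(Z)`, the convolution exponential: for each `x ∈ H` the series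
`Σ_k Z^{⋆k}(x)/k!` stabilizes (a finite sum by connectedness) with value `E(x)`. -/
def IsConvExp (Z E : H →ₗ[ℂ] LS) : Prop :=
  ∀ x : H, ∃ N : ℕ, ∀ M : ℕ, N ≤ M →
    E x = ∑ k ∈ Finset.range M, ((k.factorial : ℂ))⁻¹ • convPow Z k x

/- ℂ-valued (scalar) versions, for `β`-functions. -/

/-- Convolution product of ℂ-valued linear maps on a Hopf algebra. -/
def convC (f g : H →ₗ[ℂ] ℂ) : H →ₗ[ℂ] ℂ :=
  LinearMap.mul' ℂ ℂ ∘ₗ TensorProduct.map f g ∘ₗ Coalgebra.comul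

/-- ℂ-valued characters. -/
def IsCharacterC (φ : H →ₗ[ℂ] ℂ) : Prop :=
  φ 1 = 1 ∧ ∀ x y : H, φ (x * y) = φ x * φ y

/-- The group inverse of a ℂ-valued character. -/
def charInvC (φ : H →ₗ[ℂ] ℂ) : H →ₗ[ℂ] ℂ := φ ∘ₗ HopfAlgebra.antipode (R := ℂ)

/-- ℂ-valued infinitesimal characters. -/
def IsInfCharC (Z : H →ₗ[ℂ] ℂ) : Prop :=
  ∀ x y : H, Z (x * y) = Z x * Coalgebra.counit y + Coalgebra.counit x * Z y

end Hopf

section Graded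

variable {H : Type} [Ring H] [HopfAlgebra ℂ H]
variable (𝒜 : ℕ → Submodule ℂ H) [GradedAlgebra 𝒜]

/-- Connectedness: `H₀ = ℂ·1`. -/
def IsConnectedGrading : Prop := 𝒜 0 = Submodule.span ℂ {(1 : H)}

/-- The coproduct is grading-preserving: `Δ(H_n) ⊆ Σ_{i+j=n} H_i ⊗ H_j`. -/
def ComulGraded : Prop :=
  ∀ n : ℕ, ∀ x ∈ 𝒜 n, Coalgebra.comul (R := ℂ) x ∈
    ⨆ p : {p : ℕ × ℕ // p.1 + p.2 = n},
      LinearMap.range (TensorProduct.map ((𝒜 p.1.1).subtype) ((𝒜 p.1.2).subtype))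

/-- The counit is grading-preserving: it vanishes in positive degrees. -/
def CounitGraded : Prop := ∀ n : ℕ, 0 < n → ∀ x ∈ 𝒜 n, Coalgebra.counit (R := ℂ) x = 0

/-- The antipode is grading-preserving. -/
def AntipodeGraded : Prop := ∀ n : ℕ, ∀ x ∈ 𝒜 n, HopfAlgebra.antipode (R := ℂ) x ∈ 𝒜 n

/-- The grading biderivation `Y(x) = n·x` for `x ∈ H_n`. -/
def Ymap : H →ₗ[ℂ] H :=
  (DFinsupp.lsum ℕ fun n : ℕ => ((n : ℂ) • (𝒜 n).subtype)) ∘ₗ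
    (DirectSum.decomposeLinearEquiv 𝒜).toLinearMap

/-- `φ^t`, defined by `φ^t(x) = e^{tλn}·φ(x)` for homogeneous `x` of degree `n`. -/
def charScale (t : ℂ) (φ : H →ₗ[ℂ] LS) : H →ₗ[ℂ] LS :=
  (DFinsupp.lsum ℕ fun n : ℕ => (expL (t * (n : ℂ)) • (φ ∘ₗ (𝒜 n).subtype))) ∘ₗ
    (DirectSum.decomposeLinearEquiv 𝒜).toLinearMap

/-- `R̃(φ) = φ^{-1} ⋆ (φ ∘ Y)`. -/
def Rtilde (φ : H →ₗ[ℂ] LS) : H →ₗ[ℂ] LS := conv (charInv φ) (φ ∘ₗ Ymap 𝒜)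

/-- `(φm, φp)` is the Birkhoff decomposition of `φ`: `φ = φm^{-1} ⋆ φp`, i.e. `φm ⋆ φ = φp`,
with `φp` holomorphic and `φm − ε` a pure pole part. -/
def IsBirkhoff (φ φm φp : H →ₗ[ℂ] LS) : Prop :=
  IsCharacter φm ∧ IsCharacter φp ∧ (∀ x, Aplus (φp x)) ∧
    (∀ x, Aminus (φm x - epsA x)) ∧ conv φm φ = φp

/-- A character is local if the negative Birkhoff part of `φ^t` is independent of `t`. -/
def IsLocal (φ : H →ₗ[ℂ] LS) : Prop :=
  IsCharacter φ ∧ ∃ φm : H →ₗ[ℂ] LS, ∀ t : ℂ, ∃ φp, IsBirkhoff (charScale 𝒜 t φ) φm φp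

/-- `B = tildeβ_φ`:  `B(x) = (d/dt)|_{t=0} (φ^{-1} ⋆ φ^t)(x)`, coefficientwise. -/
def HasTildeBeta (φ B : H →ₗ[ℂ] LS) : Prop :=
  ∀ (x : H) (n : ℤ),
    HasDerivAt (fun t : ℂ => ((conv (charInv φ) (charScale 𝒜 t φ)) x).coeff n)
      ((B x).coeff n) 0

/-- The `β`-function `β_φ = −(Res φ₋) ∘ Y` of a local character whose negative
Birkhoff part is `φm`. -/
def betaFn (φm : H →ₗ[ℂ] LS) : H → ℂ := fun x => -((φm (Ymap 𝒜 x)).coeff (-1))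

end Graded

section Curves

variable {H : Type} [Ring H] [HopfAlgebra ℂ H]

/-- Pointwise (coefficientwise) derivative of a curve of maps `H → A`. -/
def HasDerivAtF (F : ℝ → (H →ₗ[ℂ] LS)) (F' : H →ₗ[ℂ] LS) (t : ℝ) : Prop :=
  ∀ (x : H) (n : ℤ), HasDerivAt (fun s : ℝ => ((F s) x).coeff n) ((F' x).coeff n) t

/-- Pointwise differentiability of a curve of maps `H → A`. -/
def PointwiseDifferentiable (F : ℝ → (H →ₗ[ℂ] LS)) : Prop :=
  ∀ (x : H) (n : ℤ), Differentiable ℝ (fun s : ℝ => ((F s) x).coeff n)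

end Curves

/-- The operator `R = P₊ − P₋` on Laurent series. -/
def Rop : LS →ₗ[ℂ] LS where
  toFun f :=
    { coeff := fun n => if n < 0 then -f.coeff n else f.coeff n
      isPWO_support' := f.isPWO_support'.mono (by
        intro n hn
        simp only [Function.mem_support] at hn ⊢
        by_cases h : n < 0 <;> simp_all) }
  map_add' f g := by
    ext n
    by_cases h : n < 0 <;> simp [h] <;> ring
  map_smul' c f := by
    ext n
    by_cases h : n < 0 <;> simp [h]


section Helpers

lemma aplus_zero : Aplus 0 := fun n _ => by simp

lemma aplus_add {a b : LS} (ha : Aplus a) (hb : Aplus b) : Aplus (a + b) := fun n hn => by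
  simp [ha n hn, hb n hn]

lemma aplus_sub {a b : LS} (ha : Aplus a) (hb : Aplus b) : Aplus (a - b) := fun n hn => by
  simp [ha n hn, hb n hn]

lemma aminus_sub {a b : LS} (ha : Aminus a) (hb : Aminus b) : Aminus (a - b) := fun n hn => by
  simp [ha n hn, hb n hn]

lemma aplus_mul {a b : LS} (ha : Aplus a) (hb : Aplus b) : Aplus (a * b) := fun n hn => by
  rw [HahnSeries.coeff_mul]
  refine Finset.sum_eq_zero fun ij hij => ?_
  rw [Finset.mem_antidiagonal] at hij
  rcases lt_or_ge ij.1 0 with h | h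
  · rw [ha _ h, zero_mul]
  · rw [hb _ (by omega), mul_zero]

lemma aminus_mul {a b : LS} (ha : Aminus a) (hb : Aminus b) : Aminus (a * b) := fun n hn => by
  rw [HahnSeries.coeff_mul]
  refine Finset.sum_eq_zero fun ij hij => ?_
  rw [Finset.mem_antidiagonal] at hij
  rcases lt_or_ge ij.1 0 with h | h
  · rw [hb _ (by omega), mul_zero]
  · rw [ha _ h, zero_mul]

lemma aplus_aminus {a : LS} (ha : Aplus a) (hb : Aminus a) : a = 0 := by
  ext n
  rcases lt_or_ge n 0 with h | h
  · simpa using ha n h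
  · simpa using hb n h

lemma expL_eq (c : ℂ) : expL c =
    HahnSeries.ofPowerSeries ℤ ℂ (PowerSeries.rescale c (PowerSeries.exp ℂ)) := by
  unfold expL
  congr 1
  ext k
  simp [PowerSeries.coeff_rescale, PowerSeries.coeff_exp, div_eq_mul_inv]

lemma expL_add (a b : ℂ) : expL (a + b) = expL a * expL b := by
  rw [expL_eq, expL_eq, expL_eq, ← map_mul, PowerSeries.exp_mul_exp_eq_exp_add]

lemma expL_zero : expL 0 = 1 := by
  rw [expL_eq]
  simp

lemma ofPS_coeff_neg (p : PowerSeries ℂ) : Aplus (HahnSeries.ofPowerSeries ℤ ℂ p) := by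
  intro n hn
  rw [HahnSeries.ofPowerSeries_apply]
  apply HahnSeries.embDomain_of_notMem_range
  rintro ⟨k, hk⟩
  simp at hk
  omega

lemma aplus_expL (c : ℂ) : Aplus (expL c) := ofPS_coeff_neg _

/-- Derivative at `0` in power series form. -/
lemma ps_deriv (n : ℂ) (p : PowerSeries ℂ) (m : ℕ) :
    HasDerivAt (fun t : ℂ => PowerSeries.coeff m
        ((PowerSeries.mk fun k => (t * n) ^ k / (k.factorial : ℂ)) * p))
      (PowerSeries.coeff m (PowerSeries.X * (PowerSeries.C n * p))) 0 := by
  have key : ∀ ij ∈ Finset.HasAntidiagonal.antidiagonal m, HasDerivAt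
      (fun t : ℂ => (t * n) ^ ij.1 / (ij.1.factorial : ℂ) * PowerSeries.coeff ij.2 p)
      (PowerSeries.coeff ij.1 (PowerSeries.X : PowerSeries ℂ) *
        PowerSeries.coeff ij.2 (PowerSeries.C n * p)) 0 := by
    intro ij _
    have h1 : HasDerivAt (fun t : ℂ => t * n) n 0 := by
      simpa using (hasDerivAt_id (0 : ℂ)).mul_const n
    have h2 := ((h1.pow ij.1).div_const (ij.1.factorial : ℂ)).mul_const (PowerSeries.coeff ij.2 p)
    refine HasDerivAt.congr_deriv h2 ?_
    rw [PowerSeries.coeff_X, PowerSeries.coeff_C_mul]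
    rcases ij with ⟨i, j⟩
    rcases i with _ | _ | i
    · simp
    · simp
    · simp
  have := HasDerivAt.fun_sum key
  rw [PowerSeries.coeff_mul]
  simp only [PowerSeries.coeff_mul m, PowerSeries.coeff_mk]
  exact this

lemma exp_deriv0 (n : ℂ) (a : LS) (m : ℤ) :
    HasDerivAt (fun t : ℂ => (expL (t * n) * a).coeff m) ((lam * (n • a)).coeff m) 0 := by
  have ha : a = HahnSeries.single a.order 1 * HahnSeries.ofPowerSeries ℤ ℂ a.powerSeriesPart :=
    (LaurentSeries.single_order_mul_powerSeriesPart a).symm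
  set N := a.order
  set p := a.powerSeriesPart
  have e1 : ∀ q : PowerSeries ℂ, (HahnSeries.single N (1 : ℂ) * HahnSeries.ofPowerSeries ℤ ℂ q).coeff m
      = (HahnSeries.ofPowerSeries ℤ ℂ q).coeff (m - N) := by
    intro q
    have := HahnSeries.coeff_single_mul_add (r := (1 : ℂ)) (x := HahnSeries.ofPowerSeries ℤ ℂ q)
      (a := m - N) (b := N)
    simpa using this
  have e2 : ∀ t : ℂ, expL (t * n) * a = HahnSeries.single N (1 : ℂ) *
      HahnSeries.ofPowerSeries ℤ ℂ ((PowerSeries.mk fun k => (t * n) ^ k / (k.factorial : ℂ)) * p) := by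
    intro t
    rw [map_mul]
    conv_lhs => rw [ha]
    unfold expL
    ring
  have e3 : lam * (n • a) = HahnSeries.single N (1 : ℂ) *
      HahnSeries.ofPowerSeries ℤ ℂ (PowerSeries.X * (PowerSeries.C n * p)) := by
    rw [map_mul, map_mul, ← HahnSeries.single_zero_mul_eq_smul, HahnSeries.ofPowerSeries_X,
      HahnSeries.ofPowerSeries_C]
    conv_lhs => rw [ha]
    unfold lam
    change _ = _ * (_ * (HahnSeries.single 0 n * _))
    ring
  simp only [e2, e3, e1]
  rcases lt_or_ge (m - N) 0 with h | h
  · simp only [ofPS_coeff_neg _ _ h]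
    exact hasDerivAt_const _ _
  · obtain ⟨k, hk⟩ := Int.eq_ofNat_of_zero_le h
    rw [hk]
    have := ps_deriv n p k
    simp only [HahnSeries.ofPowerSeries_apply_coeff]
    exact this

lemma exp_deriv (n : ℂ) (a : LS) (m : ℤ) (t : ℂ) :
    HasDerivAt (fun t : ℂ => (expL (t * n) * a).coeff m)
      ((lam * (n • (expL (t * n) * a))).coeff m) t := by
  have h := exp_deriv0 n (expL (t * n) * a) m
  have h2 : HasDerivAt (fun s : ℂ => s - t) 1 t := (hasDerivAt_id t).sub_const t
  have h3 : HasDerivAt (fun s : ℂ => (expL (s * n) * (expL (t * n) * a)).coeff m)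
      ((lam * (n • (expL (t * n) * a))).coeff m) (t - t) := by rwa [sub_self]
  have h4 := HasDerivAt.comp (h := fun s : ℂ => s - t) t h3 h2
  rw [mul_one] at h4
  have h5 : (fun s : ℂ => (expL (s * n) * a).coeff m) =
      (fun s => (expL (s * n) * (expL (t * n) * a)).coeff m) ∘ fun s => s - t := by
    ext s
    simp only [Function.comp]
    rw [← mul_assoc, ← expL_add]
    congr 3
    ring
  rw [h5]
  exact h4

variable {H : Type} [CommRing H] [HopfAlgebra ℂ H]

/-- The multiplication-after-tensor map. -/
abbrev mm (u v : H →ₗ[ℂ] LS) : H ⊗[ℂ] H →ₗ[ℂ] LS := LinearMap.mul' ℂ LS ∘ₗ TensorProduct.map u v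

lemma mm_tmul (u v : H →ₗ[ℂ] LS) (a b : H) : mm u v (a ⊗ₜ b) = u a * v b := by simp [mm]

lemma conv_apply (u v : H →ₗ[ℂ] LS) (x : H) :
    conv u v x = mm u v (Coalgebra.comul (R := ℂ) x) := rfl

lemma conv_assoc (u v w : H →ₗ[ℂ] LS) : conv (conv u v) w = conv u (conv v w) := by
  have := mul_assoc (WithConv.toConv u) (WithConv.toConv v) (WithConv.toConv w)
  exact congrArg WithConv.ofConv this

lemma conv_sub_right (u v w : H →ₗ[ℂ] LS) : conv u (v - w) = conv u v - conv u w := by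
  have := mul_sub (WithConv.toConv u) (WithConv.toConv v) (WithConv.toConv w)
  exact congrArg WithConv.ofConv this

lemma conv_sub_left (u v w : H →ₗ[ℂ] LS) : conv (u - v) w = conv u w - conv v w := by
  have := sub_mul (WithConv.toConv u) (WithConv.toConv v) (WithConv.toConv w)
  exact congrArg WithConv.ofConv this

lemma epsA_apply (x : H) : epsA x = Coalgebra.counit (R := ℂ) x • (1 : LS) := by
  simp [epsA]

lemma conv_eps (u : H →ₗ[ℂ] LS) : conv u epsA = u := by
  ext1 x
  have h := congrArg (fun z => LinearMap.mul' ℂ LS (TensorProduct.map u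
    (LinearMap.toSpanSingleton ℂ LS 1) z)) (Coalgebra.lTensor_counit_comul (R := ℂ) x)
  simp only [TensorProduct.map_tmul, LinearMap.mul'_apply, LinearMap.toSpanSingleton_apply,
    one_smul, mul_one] at h
  rw [← h, conv_apply]
  generalize Coalgebra.comul (R := ℂ) x = z
  induction z using TensorProduct.induction_on with
  | zero => simp
  | tmul a b => simp [epsA]
  | add a b ha hb => simp only [map_add, ha, hb]

lemma eps_conv (u : H →ₗ[ℂ] LS) : conv epsA u = u := by
  ext1 x
  have h := congrArg (fun z => LinearMap.mul' ℂ LS (TensorProduct.map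
    (LinearMap.toSpanSingleton ℂ LS 1) u z)) (Coalgebra.rTensor_counit_comul (R := ℂ) x)
  simp only [TensorProduct.map_tmul, LinearMap.mul'_apply, LinearMap.toSpanSingleton_apply,
    one_smul, one_mul] at h
  rw [← h, conv_apply]
  generalize Coalgebra.comul (R := ℂ) x = z
  induction z using TensorProduct.induction_on with
  | zero => simp
  | tmul a b => simp [epsA]
  | add a b ha hb => simp only [map_add, ha, hb]

lemma char_algebraMap {φ : H →ₗ[ℂ] LS} (hφ : IsCharacter φ) (c : ℂ) :
    φ (algebraMap ℂ H c) = c • (1 : LS) := by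
  rw [Algebra.algebraMap_eq_smul_one, map_smul, hφ.1]

lemma inv_conv {φ : H →ₗ[ℂ] LS} (hφ : IsCharacter φ) : conv (charInv φ) φ = epsA := by
  ext1 x
  have h := congrArg φ (HopfAlgebra.mul_antipode_rTensor_comul_apply (R := ℂ) x)
  rw [char_algebraMap hφ] at h
  rw [epsA_apply, ← h, conv_apply]
  generalize Coalgebra.comul (R := ℂ) x = z
  induction z using TensorProduct.induction_on with
  | zero => simp
  | tmul a b => simp [charInv, hφ.2]
  | add a b ha hb => simp only [map_add, ha, hb]

lemma conv_inv {φ : H →ₗ[ℂ] LS} (hφ : IsCharacter φ) : conv φ (charInv φ) = epsA := by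
  ext1 x
  have h := congrArg φ (HopfAlgebra.mul_antipode_lTensor_comul_apply (R := ℂ) x)
  rw [char_algebraMap hφ] at h
  rw [epsA_apply, ← h, conv_apply]
  generalize Coalgebra.comul (R := ℂ) x = z
  induction z using TensorProduct.induction_on with
  | zero => simp
  | tmul a b => simp [charInv, hφ.2]
  | add a b ha hb => simp only [map_add, ha, hb]

lemma mm_mul {u v : H →ₗ[ℂ] LS} (hu : IsCharacter u) (hv : IsCharacter v) (z w : H ⊗[ℂ] H) :
    mm u v (z * w) = mm u v z * mm u v w := by
  induction z using TensorProduct.induction_on with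
  | zero => simp
  | add a b ha hb => simp only [map_add, add_mul, ha, hb]
  | tmul a b =>
    induction w using TensorProduct.induction_on with
    | zero => simp
    | add a b ha hb => simp only [map_add, mul_add, ha, hb]
    | tmul c d =>
      rw [Algebra.TensorProduct.tmul_mul_tmul, mm_tmul, mm_tmul, mm_tmul, hu.2, hv.2]
      ring

lemma conv_char {u v : H →ₗ[ℂ] LS} (hu : IsCharacter u) (hv : IsCharacter v) :
    IsCharacter (conv u v) := by
  constructor
  · rw [conv_apply, Bialgebra.comul_one, Algebra.TensorProduct.one_def, mm_tmul, hu.1, hv.1, mul_one]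
  · intro x y
    rw [conv_apply, conv_apply, conv_apply, Bialgebra.comul_mul, mm_mul hu hv]

lemma aplus_conv {u v : H →ₗ[ℂ] LS} (hu : ∀ x, Aplus (u x)) (hv : ∀ x, Aplus (v x)) (x : H) :
    Aplus (conv u v x) := by
  rw [conv_apply]
  generalize Coalgebra.comul (R := ℂ) x = z
  induction z using TensorProduct.induction_on with
  | zero => simpa using aplus_zero
  | tmul a b => rw [mm_tmul]; exact aplus_mul (hu a) (hv b)
  | add a b ha hb => rw [map_add]; exact aplus_add ha hb

lemma lam_conv_right {u v : H →ₗ[ℂ] LS} (hu : ∀ x, Aplus (u x)) (hv : ∀ x, Aplus (lam * v x))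
    (x : H) : Aplus (lam * conv u v x) := by
  rw [conv_apply]
  generalize Coalgebra.comul (R := ℂ) x = z
  induction z using TensorProduct.induction_on with
  | zero => simpa using aplus_zero
  | tmul a b => rw [mm_tmul, mul_left_comm]; exact aplus_mul (hu a) (hv b)
  | add a b ha hb => rw [map_add, mul_add]; exact aplus_add ha hb

lemma lam_conv_left {u v : H →ₗ[ℂ] LS} (hu : ∀ x, Aplus (lam * u x)) (hv : ∀ x, Aplus (v x))
    (x : H) : Aplus (lam * conv u v x) := by
  rw [conv_apply]
  generalize Coalgebra.comul (R := ℂ) x = z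
  induction z using TensorProduct.induction_on with
  | zero => simpa using aplus_zero
  | tmul a b => rw [mm_tmul, ← mul_assoc]; exact aplus_mul (hu a) (hv b)
  | add a b ha hb => rw [map_add, mul_add]; exact aplus_add ha hb

variable (𝒜 : ℕ → Submodule ℂ H) [GradedAlgebra 𝒜]

lemma comul_pred (hΔ : ComulGraded 𝒜) {n : ℕ} {x : H} (hx : x ∈ 𝒜 n) (P : H ⊗[ℂ] H → Prop)
    (h0 : P 0) (hadd : ∀ z w, P z → P w → P (z + w))
    (ht : ∀ i j, i + j = n → ∀ a ∈ 𝒜 i, ∀ b ∈ 𝒜 j, P (a ⊗ₜ b)) :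
    P (Coalgebra.comul (R := ℂ) x) := by
  refine Submodule.iSup_induction _ (motive := P) (hΔ n x hx) ?_ h0 hadd
  rintro ⟨⟨i, j⟩, hij⟩ z ⟨w, rfl⟩
  induction w using TensorProduct.induction_on with
  | zero => simpa using h0
  | tmul a b => simpa using ht i j hij a a.2 b b.2
  | add a b ha hb => rw [map_add]; exact hadd _ _ ha hb

lemma graded_ind (P : H → Prop) (hadd : ∀ x y, P x → P y → P (x + y))
    (hh : ∀ n, ∀ x ∈ 𝒜 n, P x) (x : H) : P x :=
  DirectSum.Decomposition.inductionOn 𝒜 (motive := P) (hh 0 0 (zero_mem _))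
    (fun {i} m => hh i m m.2) hadd x

lemma graded_ext {u v : H →ₗ[ℂ] LS} (h : ∀ n, ∀ x ∈ 𝒜 n, u x = v x) : u = v := by
  ext1 x
  refine graded_ind 𝒜 (fun x => u x = v x) ?_ h x
  intro x y hx hy
  rw [map_add, map_add, hx, hy]

lemma charScale_apply (t : ℂ) (φ : H →ₗ[ℂ] LS) {n : ℕ} {x : H} (hx : x ∈ 𝒜 n) :
    charScale 𝒜 t φ x = expL (t * n) * φ x := by
  lift x to 𝒜 n using hx
  have h : DirectSum.decomposeLinearEquiv 𝒜 (x : H) = DFinsupp.single n x :=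
    DirectSum.decompose_coe 𝒜 x
  rw [charScale, LinearMap.comp_apply, LinearEquiv.coe_coe, h, DFinsupp.lsum_single]
  rfl

lemma Ymap_apply {n : ℕ} {x : H} (hx : x ∈ 𝒜 n) : Ymap 𝒜 x = (n : ℂ) • x := by
  lift x to 𝒜 n using hx
  have h : DirectSum.decomposeLinearEquiv 𝒜 (x : H) = DFinsupp.single n x :=
    DirectSum.decompose_coe 𝒜 x
  rw [Ymap, LinearMap.comp_apply, LinearEquiv.coe_coe, h, DFinsupp.lsum_single]
  rfl

lemma charScale_zero (φ : H →ₗ[ℂ] LS) : charScale 𝒜 0 φ = φ := by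
  refine graded_ext 𝒜 fun n x hx => ?_
  rw [charScale_apply 𝒜 _ _ hx, zero_mul, expL_zero, one_mul]

lemma charScale_conv (hΔ : ComulGraded 𝒜) (t : ℂ) (u v : H →ₗ[ℂ] LS) :
    charScale 𝒜 t (conv u v) = conv (charScale 𝒜 t u) (charScale 𝒜 t v) := by
  refine graded_ext 𝒜 fun n x hx => ?_
  rw [charScale_apply 𝒜 _ _ hx, conv_apply, conv_apply]
  refine comul_pred 𝒜 hΔ hx (fun z => expL (t * n) * mm u v z = _) ?_ ?_ ?_
  · simp
  · intro z w hz hw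
    rw [map_add, map_add, mul_add, hz, hw]
  · rintro i j rfl a ha b hb
    rw [mm_tmul, mm_tmul, charScale_apply 𝒜 _ _ ha, charScale_apply 𝒜 _ _ hb, Nat.cast_add,
      mul_add, expL_add]
    ring

lemma charScale_char {φ : H →ₗ[ℂ] LS} (hφ : IsCharacter φ) (t : ℂ) :
    IsCharacter (charScale 𝒜 t φ) := by
  constructor
  · rw [charScale_apply 𝒜 _ _ (SetLike.GradedOne.one_mem : (1 : H) ∈ 𝒜 0), hφ.1]
    simp [expL_zero]
  · intro x y
    refine graded_ind 𝒜 (fun x => charScale 𝒜 t φ (x * y) = charScale 𝒜 t φ x * charScale 𝒜 t φ y) ?_ ?_ x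
    · intro a b ha hb
      rw [add_mul, map_add, map_add, add_mul, ha, hb]
    intro n a ha
    refine graded_ind 𝒜 (fun y => charScale 𝒜 t φ (a * y) = charScale 𝒜 t φ a * charScale 𝒜 t φ y) ?_ ?_ y
    · intro a b ha hb
      rw [mul_add, map_add, map_add, mul_add, ha, hb]
    intro k b hb
    rw [charScale_apply 𝒜 _ _ ha, charScale_apply 𝒜 _ _ hb,
      charScale_apply 𝒜 _ _ (SetLike.GradedMul.mul_mem ha hb), Nat.cast_add,
      mul_add, expL_add, hφ.2]
    ring

/-- Convolution adds the orders of vanishing. -/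
lemma conv_vanish (hΔ : ComulGraded 𝒜) {p q : ℕ} {u v : H →ₗ[ℂ] LS}
    (hu : ∀ i < p, ∀ x ∈ 𝒜 i, u x = 0) (hv : ∀ j < q, ∀ x ∈ 𝒜 j, v x = 0) {n : ℕ}
    (hn : n < p + q) {x : H} (hx : x ∈ 𝒜 n) : conv u v x = 0 := by
  rw [conv_apply]
  refine comul_pred 𝒜 hΔ hx (fun z => mm u v z = 0) (by simp) ?_ ?_
  · intro z w hz hw
    rw [map_add, hz, hw, add_zero]
  · intro i j hij a ha b hb
    rw [mm_tmul]
    rcases lt_or_ge i p with h | h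
    · rw [hu i h a ha, zero_mul]
    · rw [hv j (by omega) b hb, mul_zero]

lemma conv_scale_deriv (u φ : H →ₗ[ℂ] LS) (x : H) (m : ℤ) (t : ℂ) :
    HasDerivAt (fun t : ℂ => (conv u (charScale 𝒜 t φ) x).coeff m)
      ((lam * conv u (charScale 𝒜 t (φ ∘ₗ Ymap 𝒜)) x).coeff m) t := by
  simp only [conv_apply]
  generalize Coalgebra.comul (R := ℂ) x = z
  induction z using TensorProduct.induction_on with
  | zero => simpa using hasDerivAt_const t (0 : ℂ)
  | add a b ha hb =>
    simp only [map_add, mul_add, HahnSeries.coeff_add]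
    exact ha.add hb
  | tmul a b =>
    simp only [mm_tmul]
    refine graded_ind 𝒜 (fun b => HasDerivAt (fun t : ℂ => (u a * charScale 𝒜 t φ b).coeff m)
      ((lam * (u a * charScale 𝒜 t (φ ∘ₗ Ymap 𝒜) b)).coeff m) t) ?_ ?_ b
    · intro x y hx hy
      simp only [map_add, mul_add, HahnSeries.coeff_add]
      exact hx.add hy
    · intro n b hb
      simp only [charScale_apply 𝒜 _ _ hb, LinearMap.comp_apply, Ymap_apply 𝒜 hb, map_smul]
      have h := exp_deriv n (u a * φ b) m t
      convert h using 1
      · ext s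
        congr 1
        ring
      · congr 1
        rw [mul_smul_comm, mul_smul_comm]
        congr 2
        ring

lemma conv_Rtilde {φ : H →ₗ[ℂ] LS} (hφ : IsCharacter φ) :
    conv φ (Rtilde 𝒜 φ) = φ ∘ₗ Ymap 𝒜 := by
  rw [Rtilde, ← conv_assoc, conv_inv hφ, eps_conv]

/-- Step 1: locality forces `λ R̃(φ)` to be holomorphic. -/
lemma local_imp {φ : H →ₗ[ℂ] LS} (h : IsLocal 𝒜 φ) (x : H) : Aplus (lam * Rtilde 𝒜 φ x) := by
  obtain ⟨hφ, φm, hB⟩ := h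
  have hh : ∀ t x, Aplus (conv (charInv φ) (charScale 𝒜 t φ) x) := by
    intro t
    obtain ⟨φp, -, hφp, hpp, -, he⟩ := hB 0
    obtain ⟨φp', hm, -, hpp', -, he'⟩ := hB t
    rw [charScale_zero] at he
    have e : conv (charInv φ) (charScale 𝒜 t φ) = conv (charInv φp) φp' := by
      have e1 : conv φp (charInv φ) = φm := by
        rw [← he, conv_assoc, conv_inv hφ, conv_eps]
      rw [← he', ← e1, conv_assoc, ← conv_assoc, inv_conv hφp, eps_conv]
    rw [e]
    exact aplus_conv (fun x => hpp _) hpp'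
  intro m hm
  have hd := conv_scale_deriv 𝒜 (charInv φ) φ x m 0
  rw [charScale_zero] at hd
  have h0 : (fun t : ℂ => (conv (charInv φ) (charScale 𝒜 t φ) x).coeff m) = fun _ => 0 := by
    ext t
    exact hh t x m hm
  rw [h0] at hd
  exact hd.unique (hasDerivAt_const _ _)

lemma Rtilde_zero (hΔ : ComulGraded 𝒜) (φ : H →ₗ[ℂ] LS) {x : H} (hx : x ∈ 𝒜 0) :
    Rtilde 𝒜 φ x = 0 := by
  refine conv_vanish 𝒜 hΔ (p := 0) (q := 1) (by simp) ?_ (by simp) hx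
  intro j hj y hy
  rw [LinearMap.comp_apply, Ymap_apply 𝒜 hy]
  simp [show j = 0 by omega]

/-- Step 3: if `λ R̃(φ)` is holomorphic then so is `φ⁻¹ ⋆ φ^t`. -/
lemma imp_hol (hΔ : ComulGraded 𝒜) {φ : H →ₗ[ℂ] LS} (hφ : IsCharacter φ)
    (hR : ∀ x, Aplus (lam * Rtilde 𝒜 φ x)) (t : ℂ) (x : H) :
    Aplus (conv (charInv φ) (charScale 𝒜 t φ) x) := by
  have key : ∀ n, ∀ x ∈ 𝒜 n, ∀ t, Aplus (conv (charInv φ) (charScale 𝒜 t φ) x) := by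
    intro n
    induction n using Nat.strong_induction_on with
    | _ n ih =>
    intro x hx t m hm
    have hd : ∀ t, HasDerivAt (fun t : ℂ => (conv (charInv φ) (charScale 𝒜 t φ) x).coeff m) 0 t := by
      intro t
      have h := conv_scale_deriv 𝒜 (charInv φ) φ x m t
      rw [← conv_Rtilde 𝒜 hφ, charScale_conv 𝒜 hΔ, ← conv_assoc] at h
      suffices hs : Aplus (lam * conv (conv (charInv φ) (charScale 𝒜 t φ))
          (charScale 𝒜 t (Rtilde 𝒜 φ)) x) by
        rwa [hs m hm] at h
      rw [conv_apply]
      refine comul_pred 𝒜 hΔ hx (fun z => Aplus (lam * mm _ _ z)) ?_ ?_ ?_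
      · simpa using aplus_zero
      · intro z w hz hw
        rw [map_add, mul_add]
        exact aplus_add hz hw
      · intro i j hij a ha b hb
        rw [mm_tmul, charScale_apply 𝒜 _ _ hb]
        rcases Nat.eq_zero_or_pos j with rfl | hj
        · rw [Rtilde_zero 𝒜 hΔ φ hb]
          simpa using aplus_zero
        · have h1 := aplus_mul (ih i (by omega) a ha t) (aplus_mul (aplus_expL (t * j)) (hR b))
          convert h1 using 1
          ring
    have hc := is_const_of_deriv_eq_zero (fun t => (hd t).differentiableAt)
      (fun t => (hd t).deriv) t 0
    rw [hc, charScale_zero, inv_conv hφ, epsA_apply]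
    simp [HahnSeries.coeff_one, hm.ne]
  refine graded_ind 𝒜 (fun x => Aplus (conv (charInv φ) (charScale 𝒜 t φ) x)) ?_ ?_ x
  · intro a b ha hb
    rw [map_add]
    exact aplus_add ha hb
  · intro n x hx
    exact key n x hx t

/-- Projection onto the polar part. -/
def Pm : LS →ₗ[ℂ] LS := (2⁻¹ : ℂ) • (LinearMap.id - Rop)

lemma Pm_coeff (a : LS) (n : ℤ) : (Pm a).coeff n = if n < 0 then a.coeff n else 0 := by
  have : (Rop a).coeff n = if n < 0 then -a.coeff n else a.coeff n := rfl
  simp only [Pm, LinearMap.smul_apply, LinearMap.sub_apply, LinearMap.id_apply,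
    HahnSeries.coeff_smul, HahnSeries.coeff_sub, this]
  split_ifs <;> simp <;> ring

/-- One step of the Bogoliubov recursion. -/
def Tstep (φ ψ : H →ₗ[ℂ] LS) : H →ₗ[ℂ] LS := epsA - Pm ∘ₗ conv ψ (φ - epsA)

/-- Iterates of the Bogoliubov recursion. -/
def Titer (φ : H →ₗ[ℂ] LS) : ℕ → (H →ₗ[ℂ] LS)
  | 0 => epsA
  | k + 1 => Tstep φ (Titer φ k)

lemma char_deg0 (hconn : IsConnectedGrading 𝒜) {φ : H →ₗ[ℂ] LS} (h1 : φ 1 = 1) {x : H}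
    (hx : x ∈ 𝒜 0) : φ x = epsA x := by
  rw [hconn, Submodule.mem_span_singleton] at hx
  obtain ⟨c, rfl⟩ := hx
  rw [map_smul, map_smul, h1, epsA_apply, Bialgebra.counit_one, one_smul]

lemma Tstep_agree (hconn : IsConnectedGrading 𝒜) (hΔ : ComulGraded 𝒜) {φ : H →ₗ[ℂ] LS}
    (hφ : IsCharacter φ) {ψ ψ' : H →ₗ[ℂ] LS} {n : ℕ} (h : ∀ i < n, ∀ x ∈ 𝒜 i, ψ x = ψ' x)
    {x : H} (hx : x ∈ 𝒜 n) : Tstep φ ψ x = Tstep φ ψ' x := by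
  have h1 : conv (ψ - ψ') (φ - epsA) x = 0 := by
    refine conv_vanish 𝒜 hΔ (p := n) (q := 1) ?_ ?_ (by omega) hx
    · intro i hi y hy
      simp [h i hi y hy]
    · intro j hj y hy
      obtain rfl : j = 0 := by omega
      simp [char_deg0 𝒜 hconn hφ.1 hy]
  rw [conv_sub_left, LinearMap.sub_apply, sub_eq_zero] at h1
  simp only [Tstep, LinearMap.sub_apply, LinearMap.comp_apply, h1]

lemma Titer_stab (hconn : IsConnectedGrading 𝒜) (hΔ : ComulGraded 𝒜) {φ : H →ₗ[ℂ] LS}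
    (hφ : IsCharacter φ) (k : ℕ) :
    ∀ n < k, ∀ x ∈ 𝒜 n, Titer φ (k + 1) x = Titer φ k x := by
  induction k with
  | zero => intro n hn; omega
  | succ k ih =>
    intro n hn x hx
    exact Tstep_agree 𝒜 hconn hΔ hφ (fun i hi y hy => ih i (by omega) y hy) hx

lemma Titer_stab' (hconn : IsConnectedGrading 𝒜) (hΔ : ComulGraded 𝒜) {φ : H →ₗ[ℂ] LS}
    (hφ : IsCharacter φ) {n : ℕ} {x : H} (hx : x ∈ 𝒜 n) {k : ℕ} (hk : n + 1 ≤ k) :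
    Titer φ k x = Titer φ (n + 1) x := by
  induction k, hk using Nat.le_induction with
  | base => rfl
  | succ k hk ih => rw [Titer_stab 𝒜 hconn hΔ hφ k n (by omega) x hx, ih]

/-- The negative Birkhoff part. -/
def birkM (φ : H →ₗ[ℂ] LS) : H →ₗ[ℂ] LS :=
  (DFinsupp.lsum ℕ fun n : ℕ => (Titer φ (n + 1) ∘ₗ (𝒜 n).subtype)) ∘ₗ
    (DirectSum.decomposeLinearEquiv 𝒜).toLinearMap

lemma birkM_apply (φ : H →ₗ[ℂ] LS) {n : ℕ} {x : H} (hx : x ∈ 𝒜 n) :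
    birkM 𝒜 φ x = Titer φ (n + 1) x := by
  lift x to 𝒜 n using hx
  have h : DirectSum.decomposeLinearEquiv 𝒜 (x : H) = DFinsupp.single n x :=
    DirectSum.decompose_coe 𝒜 x
  rw [birkM, LinearMap.comp_apply, LinearEquiv.coe_coe, h, DFinsupp.lsum_single]
  rfl

lemma birkM_eq (hconn : IsConnectedGrading 𝒜) (hΔ : ComulGraded 𝒜) {φ : H →ₗ[ℂ] LS}
    (hφ : IsCharacter φ) : birkM 𝒜 φ = Tstep φ (birkM 𝒜 φ) := by
  refine graded_ext 𝒜 fun n x hx => ?_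
  rw [birkM_apply 𝒜 φ hx]
  refine Tstep_agree 𝒜 hconn hΔ hφ ?_ hx
  intro i hi y hy
  rw [birkM_apply 𝒜 φ hy, Titer_stab' 𝒜 hconn hΔ hφ hy (by omega)]

lemma exists_birkhoff (hconn : IsConnectedGrading 𝒜) (hΔ : ComulGraded 𝒜)
    (hcounit : CounitGraded 𝒜) {φ : H →ₗ[ℂ] LS} (hφ : IsCharacter φ) :
    ∃ φm φp, IsBirkhoff φ φm φp := by
  set φm := birkM 𝒜 φ with hm
  have hfix : φm = Tstep φ φm := birkM_eq 𝒜 hconn hΔ hφ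
  have hminus : ∀ x, Aminus (φm x - epsA x) := by
    intro x n hn
    rw [hfix]
    simp [Tstep, Pm_coeff, not_lt.mpr hn]
  have hplus : ∀ x, Aplus (conv φm φ x) := by
    intro x n hn
    have e : conv φm φ = φm + conv φm (φ - epsA) := by
      rw [conv_sub_right, conv_eps]
      abel
    have e2 : φm x = epsA x - Pm (conv φm (φ - epsA) x) := congrArg (fun u => u x) hfix
    rw [e, LinearMap.add_apply, e2, epsA_apply]
    simp [Pm_coeff, hn, HahnSeries.coeff_one, hn.ne]
  have hone : φm 1 = 1 := by
    have e2 : φm 1 = epsA (1 : H) - Pm (conv φm (φ - epsA) (1 : H)) :=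
      congrArg (fun u : H →ₗ[ℂ] LS => u 1) hfix
    rw [e2, conv_apply, Bialgebra.comul_one, Algebra.TensorProduct.one_def, mm_tmul, epsA_apply,
      LinearMap.sub_apply, epsA_apply, hφ.1]
    simp
  have hlin : ∀ x ∈ 𝒜 0, ∃ c : ℂ, x = c • 1 := by
    intro x hx
    rw [hconn, Submodule.mem_span_singleton] at hx
    obtain ⟨c, rfl⟩ := hx
    exact ⟨c, rfl⟩
  have hpos : ∀ n, 0 < n → ∀ x ∈ 𝒜 n, Aminus (φm x) := by
    intro n hn x hx
    have := hminus x
    have h0 : epsA x = 0 := by simp [epsA, hcounit n hn x hx]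
    rwa [h0, sub_zero] at this
  have key : ∀ N n k, n + k = N → ∀ x ∈ 𝒜 n, ∀ y ∈ 𝒜 k, φm (x * y) = φm x * φm y := by
    intro N
    induction N using Nat.strong_induction_on with
    | _ N ih =>
    intro n k hnk x hx y hy
    rcases Nat.eq_zero_or_pos n with rfl | hn
    · obtain ⟨c, rfl⟩ := hlin x hx
      simp [hone]
    rcases Nat.eq_zero_or_pos k with rfl | hk
    · obtain ⟨c, rfl⟩ := hlin y hy
      simp [hone]
    have G : mm φm φ (Coalgebra.comul (R := ℂ) x * Coalgebra.comul (R := ℂ) y)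
        - mm φm φ (Coalgebra.comul (R := ℂ) x) * mm φm φ (Coalgebra.comul (R := ℂ) y)
        - mm φm epsA (Coalgebra.comul (R := ℂ) x * Coalgebra.comul (R := ℂ) y)
        + mm φm epsA (Coalgebra.comul (R := ℂ) x) * mm φm epsA (Coalgebra.comul (R := ℂ) y)
        = 0 := by
      refine comul_pred 𝒜 hΔ hx (fun z => mm φm φ (z * Coalgebra.comul (R := ℂ) y)
        - mm φm φ z * mm φm φ (Coalgebra.comul (R := ℂ) y)
        - mm φm epsA (z * Coalgebra.comul (R := ℂ) y)
        + mm φm epsA z * mm φm epsA (Coalgebra.comul (R := ℂ) y) = 0) ?_ ?_ ?_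
      · simp
      · intro z w hz hw
        rw [add_mul, map_add, map_add, map_add, map_add]
        linear_combination hz + hw
      intro i j hij a ha b hb
      refine comul_pred 𝒜 hΔ hy (fun w => mm φm φ ((a ⊗ₜ b) * w)
        - mm φm φ (a ⊗ₜ b) * mm φm φ w - mm φm epsA ((a ⊗ₜ b) * w)
        + mm φm epsA (a ⊗ₜ b) * mm φm epsA w = 0) ?_ ?_ ?_
      · simp
      · intro z w hz hw
        rw [mul_add, map_add, map_add, map_add, map_add]
        linear_combination hz + hw
      intro i' j' hij' c hc d hd
      have heps : epsA (b * d) = epsA b * epsA d := by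
        rw [epsA_apply, epsA_apply, epsA_apply, Bialgebra.counit_mul, smul_mul_smul_comm, mul_one]
      rw [Algebra.TensorProduct.tmul_mul_tmul, mm_tmul, mm_tmul, mm_tmul, mm_tmul, mm_tmul,
        mm_tmul, hφ.2, heps]
      by_cases hjj : j = 0 ∧ j' = 0
      · obtain ⟨rfl, rfl⟩ := hjj
        rw [char_deg0 𝒜 hconn hφ.1 hb, char_deg0 𝒜 hconn hφ.1 hd]
        ring
      · rw [ih (i + i') (by omega) i i' rfl a ha c hc]
        ring
    rw [← Bialgebra.comul_mul, ← conv_apply, ← conv_apply, ← conv_apply, ← conv_apply,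
      ← conv_apply, ← conv_apply, conv_eps] at G
    have hE : φm (x * y) - φm x * φm y = conv φm φ (x * y) - conv φm φ x * conv φm φ y := by
      linear_combination -G
    have hp : Aplus (φm (x * y) - φm x * φm y) := by
      rw [hE]
      exact aplus_sub (hplus _) (aplus_mul (hplus _) (hplus _))
    have hmi : Aminus (φm (x * y) - φm x * φm y) :=
      aminus_sub (hpos (n + k) (by omega) _ (SetLike.GradedMul.mul_mem hx hy))
        (aminus_mul (hpos n hn x hx) (hpos k hk y hy))
    exact sub_eq_zero.mp (aplus_aminus hp hmi)
  have hchar : IsCharacter φm := by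
    refine ⟨hone, fun x y => ?_⟩
    refine graded_ind 𝒜 (fun x => φm (x * y) = φm x * φm y) ?_ ?_ x
    · intro a b ha hb
      rw [add_mul, map_add, map_add, add_mul, ha, hb]
    intro n a ha
    refine graded_ind 𝒜 (fun y => φm (a * y) = φm a * φm y) ?_ ?_ y
    · intro a b ha hb
      rw [mul_add, map_add, map_add, mul_add, ha, hb]
    intro k b hb
    exact key _ n k rfl a ha b hb
  exact ⟨φm, conv φm φ, hchar, conv_char hchar hφ, hplus, hminus, rfl⟩

lemma imp_local (hconn : IsConnectedGrading 𝒜) (hΔ : ComulGraded 𝒜)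
    (hcounit : CounitGraded 𝒜) {φ : H →ₗ[ℂ] LS} (hφ : IsCharacter φ)
    (hR : ∀ x, Aplus (lam * Rtilde 𝒜 φ x)) : IsLocal 𝒜 φ := by
  obtain ⟨φm, φp, hm, -, hpp, hmm, he⟩ := exists_birkhoff 𝒜 hconn hΔ hcounit hφ
  refine ⟨hφ, φm, fun t => ⟨_, hm, conv_char hm (charScale_char 𝒜 hφ t), ?_, hmm, rfl⟩⟩
  have e : conv φm (charScale 𝒜 t φ) = conv φp (conv (charInv φ) (charScale 𝒜 t φ)) := by
    rw [← he, conv_assoc, ← conv_assoc φ, conv_inv hφ, eps_conv]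
  rw [e]
  exact aplus_conv hpp (imp_hol 𝒜 hΔ hφ hR t)

end Helpers

/-- **Theorem (locality is preserved by the Lax pair flow, via `R̃`).**
Let `H` be a connected graded commutative Hopf algebra, `φ` a local character,
`f : g_A → g_A` an `Ad`-covariant map, `X = f(R̃(φ))`, and
`exp(−tX) = g₋(t)⁻¹ ⋆ g₊(t)` the Birkhoff factorization.  If `φ_t` is any
character with `R̃(φ_t) = Ad(g₊(t))(R̃(φ))` — i.e. `φ_t = R̃⁻¹(L(t))` is the
Lax pair flow `L(t) = Ad(g₊(t))(R̃(φ))` transferred back to the character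
group via the bijection `R̃` — then `φ_t` is local for all `t`. -/
theorem locality_preserved_by_lax_flow
    {H : Type} [CommRing H] [HopfAlgebra ℂ H]
    (𝒜 : ℕ → Submodule ℂ H) [GradedAlgebra 𝒜]
    (hconn : IsConnectedGrading 𝒜) (hΔ : ComulGraded 𝒜)
    (hcounit : CounitGraded 𝒜) (hS : AntipodeGraded 𝒜)
    (φ : H →ₗ[ℂ] LS) (hloc : IsLocal 𝒜 φ)
    (f : (H →ₗ[ℂ] LS) → (H →ₗ[ℂ] LS))
    (hfinf : ∀ Z : H →ₗ[ℂ] LS, IsInfChar Z → IsInfChar (f Z))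
    (hfad : ∀ g Z : H →ₗ[ℂ] LS, IsCharacter g → IsInfChar Z →
      f (Adc g Z) = Adc g (f Z))
    (gm gp : ℝ → (H →ₗ[ℂ] LS))
    (hgmchar : ∀ t, IsCharacter (gm t)) (hgpchar : ∀ t, IsCharacter (gp t))
    (hgm0 : gm 0 = epsA) (hgp0 : gp 0 = epsA)
    (hgpplus : ∀ t x, Aplus (gp t x))
    (hgmminus : ∀ t x, Aminus (gm t x - epsA x))
    (hfact : ∀ t : ℝ,
      IsConvExp ((-(t : ℂ)) • f (Rtilde 𝒜 φ)) (conv (charInv (gm t)) (gp t)))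
    (φt : ℝ → (H →ₗ[ℂ] LS)) (hφtchar : ∀ t, IsCharacter (φt t))
    (hφtR : ∀ t : ℝ, Rtilde 𝒜 (φt t) = Adc (gp t) (Rtilde 𝒜 φ)) :
    ∀ t : ℝ, IsLocal 𝒜 (φt t) := by
  intro t
  refine imp_local 𝒜 hconn hΔ hcounit (hφtchar t) ?_
  rw [hφtR t]
  exact lam_conv_right (hgpplus t)
    (lam_conv_left (local_imp 𝒜 hloc) (fun x => hgpplus t _))

end
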